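/- arXiv:2402.02531 — 3 statements merged into one kernel-verified Lean document; each statement's English description precedes it below -/
import Mathlib

section
/- Non-existence of classical solutions when the two densities have the same support (Theorem 1, case Ω₁ = Ω₂, Lagrangian formulation): Suppose there exist p0 > 0 and d0 ∈ (0,1) such that either (i) ρ0 > 0 and n0 > 0 on (0,d0), n0'(x)/n0(x) ≥ p0 for all x ∈ (0,d0], w0(d0) < 0, w0(x) ≤ 0 for all x ∈ (0,d0], and n0(x)^γ/ρ0(x) ≥ 2^{γ+4} M/(γ p0) for all x ∈ (0,d0); or (ii) ρ0 > 0 and n0 > 0 on (1−d0,1), n0'(x)/n0(x) ≤ −p0 for all x ∈ [1−d0,1), w0(1−d0) > 0, w0(x) ≥ 0 for all x ∈ [1−d0,1), and n0(x)^γ/ρ0(x) ≥ 2^{γ+4} M/(γ p0) for all x ∈ (1−d0,1). Then for every T > 0 there exists no classical solution of the Lagrangian two-phase problem on [0,1] × [0,T]. -/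
open Set MeasureTheory

/-- A classical solution `(v1, v2)` of the Lagrangian formulation of the two-phase
    (pressureless Euler)/(Navier–Stokes) problem on `[0,1] × [0,T]`, with adiabatic
    exponent `γ`, viscosity `μ`, initial densities `ρ0, n0` and initial velocities
    `u0, w0`. -/
def IsLagrangianSolution (γ : ℝ) (μ ρ0 n0 u0 w0 : ℝ → ℝ) (T : ℝ)
    (v1 v2 : ℝ → ℝ → ℝ) : Prop :=
  ∃ v1t v2t v1x v2x v1xx v2xx η1x η2x : ℝ → ℝ → ℝ,
    -- the derivatives ∂ₜvᵢ, ∂ₓvᵢ, ∂ₓₓvᵢ exist on [0,1] × [0,T]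
    (∀ x ∈ Set.Icc (0:ℝ) 1, ∀ t ∈ Set.Icc (0:ℝ) T,
      HasDerivWithinAt (fun s => v1 x s) (v1t x t) (Set.Icc 0 T) t ∧
      HasDerivWithinAt (fun s => v2 x s) (v2t x t) (Set.Icc 0 T) t ∧
      HasDerivWithinAt (fun y => v1 y t) (v1x x t) (Set.Icc 0 1) x ∧
      HasDerivWithinAt (fun y => v2 y t) (v2x x t) (Set.Icc 0 1) x ∧
      HasDerivWithinAt (fun y => v1x y t) (v1xx x t) (Set.Icc 0 1) x ∧
      HasDerivWithinAt (fun y => v2x y t) (v2xx x t) (Set.Icc 0 1) x) ∧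
    -- v1, v2 and all these derivatives are continuous on [0,1] × [0,T]
    ContinuousOn (fun p : ℝ × ℝ => v1 p.1 p.2) (Set.Icc 0 1 ×ˢ Set.Icc 0 T) ∧
    ContinuousOn (fun p : ℝ × ℝ => v2 p.1 p.2) (Set.Icc 0 1 ×ˢ Set.Icc 0 T) ∧
    ContinuousOn (fun p : ℝ × ℝ => v1t p.1 p.2) (Set.Icc 0 1 ×ˢ Set.Icc 0 T) ∧
    ContinuousOn (fun p : ℝ × ℝ => v2t p.1 p.2) (Set.Icc 0 1 ×ˢ Set.Icc 0 T) ∧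
    ContinuousOn (fun p : ℝ × ℝ => v1x p.1 p.2) (Set.Icc 0 1 ×ˢ Set.Icc 0 T) ∧
    ContinuousOn (fun p : ℝ × ℝ => v2x p.1 p.2) (Set.Icc 0 1 ×ˢ Set.Icc 0 T) ∧
    ContinuousOn (fun p : ℝ × ℝ => v1xx p.1 p.2) (Set.Icc 0 1 ×ˢ Set.Icc 0 T) ∧
    ContinuousOn (fun p : ℝ × ℝ => v2xx p.1 p.2) (Set.Icc 0 1 ×ˢ Set.Icc 0 T) ∧
    -- the flow maps ηᵢ(x,t) = x + ∫₀ᵗ vᵢ(x,s) ds have positive spatial derivatives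
    (∀ x ∈ Set.Icc (0:ℝ) 1, ∀ t ∈ Set.Icc (0:ℝ) T,
      HasDerivWithinAt (fun y => y + ∫ s in (0:ℝ)..t, v1 y s) (η1x x t) (Set.Icc 0 1) x ∧
      HasDerivWithinAt (fun y => y + ∫ s in (0:ℝ)..t, v2 y s) (η2x x t) (Set.Icc 0 1) x ∧
      0 < η1x x t ∧ 0 < η2x x t) ∧
    -- the momentum equations hold on (0,1) × (0,T]
    (∀ x ∈ Set.Ioo (0:ℝ) 1, ∀ t ∈ Set.Ioc (0:ℝ) T,
      ρ0 x * v1t x t = -(ρ0 x) * (v1 x t - v2 x t) ∧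
      ∃ Px Vx : ℝ,
        HasDerivWithinAt (fun y => n0 y ^ γ / (η2x y t) ^ γ) Px (Set.Icc 0 1) x ∧
        HasDerivWithinAt (fun y => μ (n0 y / η2x y t) * v2x y t / η2x y t) Vx
          (Set.Icc 0 1) x ∧
        n0 x * v2t x t + Px = Vx + ρ0 x * (η2x x t / η1x x t) * (v1 x t - v2 x t)) ∧
    -- boundary conditions
    (∀ t ∈ Set.Ioc (0:ℝ) T, v2 0 t = 0 ∧ v2 1 t = 0 ∧ v2x 0 t = 0 ∧ v2x 1 t = 0) ∧
    -- initial conditions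
    (∀ x ∈ Set.Icc (0:ℝ) 1, v1 x 0 = u0 x ∧ v2 x 0 = w0 x)

theorem first_second_deriv_of_max_Ioo {f f' : ℝ → ℝ} {a b c x : ℝ}
    (hx : x ∈ Ioo a b) (hf : ∀ y ∈ Ioo a b, HasDerivAt f (f' y) y)
    (hf' : HasDerivAt f' c x) (hmax : ∀ y ∈ Ioo a b, f y ≤ f x) : f' x = 0 ∧ c ≤ 0 := by
  have hnhds : Ioo a b ∈ nhds x := Ioo_mem_nhds hx.1 hx.2
  have hlm : IsLocalMax f x := by filter_upwards [hnhds] with y hy using hmax y hy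
  have h0 : f' x = 0 := hlm.hasDerivAt_eq_zero (hf x hx)
  refine ⟨h0, ?_⟩
  by_contra! hc
  have hd : deriv f =ᶠ[nhds x] f' := by
    filter_upwards [hnhds] with y hy using (hf y hy).deriv
  have hdd : deriv (deriv f) x = c := by rw [hd.deriv_eq, hf'.deriv]
  have hmin : IsLocalMin f x := isLocalMin_of_deriv_deriv_pos (by rw [hdd]; exact hc)
    (by rw [(hf x hx).deriv, h0]) (hf x hx).continuousAt
  have hconst : f =ᶠ[nhds x] fun _ => f x := by
    filter_upwards [hlm, hmin] with y h1 h2 using le_antisymm h1 h2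
  have := hconst.deriv.deriv_eq
  rw [hdd] at this
  simp at this
  linarith

theorem HasDerivWithinAt.nonpos_of_le_right {f : ℝ → ℝ} {c a b : ℝ} {s : Set ℝ}
    (hab : a < b) (hs : Icc a b ⊆ s) (hf : HasDerivWithinAt f c s a)
    (hmax : ∀ y ∈ Icc a b, f y ≤ f a) : c ≤ 0 := by
  have hl : IsLocalMaxOn f (Icc a b) a := by
    filter_upwards [self_mem_nhdsWithin] with y hy using hmax y hy
  have h := hl.hasFDerivWithinAt_nonpos (hf.mono hs).hasFDerivWithinAt
    (y := b - a) (mem_posTangentConeAt_of_segment_subset (by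
      rw [add_sub_cancel, segment_eq_Icc hab.le]))
  simp at h
  nlinarith

theorem HasDerivWithinAt.nonneg_of_le_left {f : ℝ → ℝ} {c a b : ℝ} {s : Set ℝ}
    (hab : a < b) (hs : Icc a b ⊆ s) (hf : HasDerivWithinAt f c s b)
    (hmax : ∀ y ∈ Icc a b, f y ≤ f b) : 0 ≤ c := by
  have hl : IsLocalMaxOn f (Icc a b) b := by
    filter_upwards [self_mem_nhdsWithin] with y hy using hmax y hy
  have h := hl.hasFDerivWithinAt_nonpos (hf.mono hs).hasFDerivWithinAt
    (y := a - b) (mem_posTangentConeAt_of_segment_subset (by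
      rw [add_sub_cancel, segment_symm, segment_eq_Icc hab.le]))
  simp at h
  nlinarith

theorem hasDerivAt_integral_of_continuousOn_rect {f fx : ℝ → ℝ → ℝ} {T t x : ℝ}
    (hf : ContinuousOn (fun p : ℝ × ℝ => f p.1 p.2) (Icc 0 1 ×ˢ Icc 0 T))
    (hfx : ContinuousOn (fun p : ℝ × ℝ => fx p.1 p.2) (Icc 0 1 ×ˢ Icc 0 T))
    (hd : ∀ y ∈ Icc (0:ℝ) 1, ∀ s ∈ Icc (0:ℝ) T,
      HasDerivWithinAt (fun z => f z s) (fx y s) (Icc 0 1) y)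
    (ht : t ∈ Icc (0:ℝ) T) (hx : x ∈ Ioo (0:ℝ) 1) :
    HasDerivAt (fun y => ∫ s in (0:ℝ)..t, f y s) (∫ s in (0:ℝ)..t, fx x s) x := by
  obtain ⟨K, hK⟩ := (isCompact_Icc.prod isCompact_Icc).exists_bound_of_continuousOn hfx
  have hsub : uIcc 0 t ⊆ Icc 0 T := by
    rw [uIcc_of_le ht.1]; exact Icc_subset_Icc_right ht.2
  have hslice : ∀ (g : ℝ → ℝ → ℝ),
      ContinuousOn (fun p : ℝ × ℝ => g p.1 p.2) (Icc 0 1 ×ˢ Icc 0 T) →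
      ∀ y ∈ Ioo (0:ℝ) 1, IntervalIntegrable (g y) volume 0 t := fun g hg y hy =>
    ContinuousOn.intervalIntegrable
      (hg.comp (f := fun s => (y, s)) (by fun_prop) fun s hs => ⟨Ioo_subset_Icc_self hy, hsub hs⟩)
  have hnhds : Ioo (0:ℝ) 1 ∈ nhds x := Ioo_mem_nhds hx.1 hx.2
  refine (intervalIntegral.hasDerivAt_integral_of_dominated_loc_of_deriv_le
    (F := f) (F' := fx) (bound := fun _ => K) hnhds ?_ (hslice f hf x hx) ?_ ?_ (by simp) ?_).2
  · filter_upwards [hnhds] with y hy using 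
      (intervalIntegrable_iff.1 (hslice f hf y hy)).aestronglyMeasurable
  · exact (intervalIntegrable_iff.1 (hslice fx hfx x hx)).aestronglyMeasurable
  · exact Filter.Eventually.of_forall fun s hs y hy =>
      hK (y, s) ⟨Ioo_subset_Icc_self hy, hsub (uIoc_subset_uIcc hs)⟩
  · exact Filter.Eventually.of_forall fun s hs y hy =>
      (hd y (Ioo_subset_Icc_self hy) s (hsub (uIoc_subset_uIcc hs))).hasDerivAt
        (Icc_mem_nhds hy.1 hy.2)

/-- Hopf-type boundary estimate for strict subsolutions of the degenerate parabolic operator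
`c ∂ₜ - a ∂ₓₓ - b ∂ₓ`, where `c ≥ 0` may vanish while `a` is bounded below. -/
theorem exists_linear_bound_of_parabolic_subsolution {v vt vx vxx : ℝ → ℝ → ℝ}
    {d τ a₀ b₀ c₀ δ : ℝ} (hd : 0 < d) (hτ : 0 < τ) (ha₀ : 0 < a₀) (hδ : 0 < δ)
    (hv : ContinuousOn (fun p : ℝ × ℝ => v p.1 p.2) (Icc 0 d ×ˢ Icc 0 τ))
    (hvt : ∀ x ∈ Ioo 0 d, ∀ t ∈ Ioc 0 τ,
      HasDerivWithinAt (fun s => v x s) (vt x t) (Icc 0 τ) t)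
    (hvx : ∀ x ∈ Ioo 0 d, ∀ t ∈ Ioc 0 τ, HasDerivAt (fun y => v y t) (vx x t) x)
    (hvxx : ∀ x ∈ Ioo 0 d, ∀ t ∈ Ioc 0 τ, HasDerivAt (fun y => vx y t) (vxx x t) x)
    (hsub : ∀ x ∈ Ioo 0 d, ∀ t ∈ Ioc 0 τ, ∃ a b c : ℝ, a₀ ≤ a ∧ |b| ≤ b₀ ∧ 0 ≤ c ∧ c ≤ c₀ ∧
      c * vt x t < a * vxx x t + b * vx x t)
    (hleft : ∀ t ∈ Icc 0 τ, v 0 t ≤ 0) (hinit : ∀ x ∈ Icc 0 d, v x 0 ≤ 0)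
    (hright : ∀ t ∈ Icc 0 τ, v d t ≤ -δ) :
    ∃ k > 0, ∀ x ∈ Icc 0 d, v x τ ≤ -k * x := by
  obtain ⟨a, b, c, ha, hb, hc, hcc, -⟩ := hsub (d / 2) ⟨by linarith, by linarith⟩ τ ⟨hτ, le_rfl⟩
  have hc₀ : 0 ≤ c₀ := hc.trans hcc
  have hb₀ : 0 ≤ b₀ := (abs_nonneg b).trans hb
  clear a b c ha hb hc hcc
  obtain ⟨l, hl⟩ : ∃ l, l = (c₀ * (d / τ) + b₀) / a₀ + 1 := ⟨_, rfl⟩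
  have hdτ : 0 < d / τ := div_pos hd hτ
  have hlpos : 0 < l := by rw [hl]; positivity
  have hal : c₀ * (d / τ) + b₀ ≤ a₀ * l := by
    rw [hl, mul_add, mul_div_cancel₀ _ ha₀.ne']; linarith
  obtain ⟨φ, hφ⟩ : ∃ φ : ℝ → ℝ → ℝ, φ = fun x t => Real.exp (l * (x - d + d / τ * t)) - 1 :=
    ⟨_, rfl⟩
  have hφx : ∀ x t, HasDerivAt (fun y => φ y t)
      (l * Real.exp (l * (x - d + d / τ * t))) x := fun x t => by
    simp only [hφ]
    have h :=
      (((((hasDerivAt_id x).sub_const d).add_const (d / τ * t)).const_mul l).exp).sub_const 1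
    exact h.congr_deriv (by simp only [id]; ring)
  have hφxx : ∀ x t, HasDerivAt (fun y => l * Real.exp (l * (y - d + d / τ * t)))
      (l * l * Real.exp (l * (x - d + d / τ * t))) x := fun x t => by
    have h :=
      (((((hasDerivAt_id x).sub_const d).add_const (d / τ * t)).const_mul l).exp).const_mul l
    exact h.congr_deriv (by simp only [id]; ring)
  have hφt : ∀ x t, HasDerivAt (fun s => φ x s)
      (l * (d / τ) * Real.exp (l * (x - d + d / τ * t))) t := fun x t => by
    simp only [hφ]
    have h :=
      (((((hasDerivAt_id t).const_mul (d / τ)).const_add (x - d)).const_mul l).exp).sub_const 1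
    exact h.congr_deriv (by simp only [id]; ring)
  have hφcont : Continuous fun p : ℝ × ℝ => φ p.1 p.2 := by
    simp only [hφ]; fun_prop
  have hφnonpos : ∀ x t, x - d + d / τ * t ≤ 0 → φ x t ≤ 0 := fun x t h => by
    simp only [hφ, sub_nonpos, Real.exp_le_one_iff]
    exact mul_nonpos_of_nonneg_of_nonpos hlpos.le h
  have hdt : ∀ t ∈ Icc 0 τ, d / τ * t ≤ d := fun t ht => by
    rw [div_mul_eq_mul_div, div_le_iff₀ hτ]; exact mul_le_mul_of_nonneg_left ht.2 hd.le
  obtain ⟨ε, hε⟩ : ∃ ε, ε = δ / Real.exp (l * d) := ⟨_, rfl⟩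
  have hεpos : 0 < ε := by rw [hε]; positivity
  have hφright : ∀ t ∈ Icc 0 τ, ε * max (φ d t) 0 ≤ δ := fun t ht => by
    have h1 : max (φ d t) 0 ≤ Real.exp (l * d) := by
      refine max_le ?_ (Real.exp_pos _).le
      have : Real.exp (l * (d - d + d / τ * t)) ≤ Real.exp (l * d) := by
        rw [sub_self, zero_add]
        exact Real.exp_le_exp.2 (mul_le_mul_of_nonneg_left (hdt t ht) hlpos.le)
      simp only [hφ]; linarith
    calc ε * max (φ d t) 0 ≤ ε * Real.exp (l * d) := mul_le_mul_of_nonneg_left h1 hεpos.le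
      _ = δ := by rw [hε, div_mul_cancel₀ _ (Real.exp_pos _).ne']
  have hmain : ∀ p ∈ Icc 0 d ×ˢ Icc 0 τ, v p.1 p.2 + ε * max (φ p.1 p.2) 0 ≤ 0 := by
    obtain ⟨⟨x, t⟩, ⟨hx, ht⟩, hmax⟩ := (isCompact_Icc.prod isCompact_Icc).exists_isMaxOn
      (⟨(0, 0), ⟨left_mem_Icc.2 hd.le, left_mem_Icc.2 hτ.le⟩⟩ :
        (Icc 0 d ×ˢ Icc 0 τ).Nonempty)
      (f := fun p : ℝ × ℝ => v p.1 p.2 + ε * max (φ p.1 p.2) 0)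
      (hv.add (Continuous.continuousOn (continuous_const.mul (hφcont.max continuous_const))))
    rw [isMaxOn_iff] at hmax
    dsimp only at hx ht hmax
    refine fun p hp => (hmax p hp).trans ?_
    by_contra! hpos
    have hx0 : 0 < x := by
      refine hx.1.lt_of_ne fun h => ?_
      subst h
      rw [max_eq_right (hφnonpos 0 t (by linarith [hdt t ht]))] at hpos
      linarith [hleft t ht]
    have hxd : x < d := by
      refine hx.2.lt_of_ne fun h => ?_
      subst h
      linarith [hright t ht, hφright t ht]
    have ht0 : 0 < t := by
      refine ht.1.lt_of_ne fun h => ?_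
      subst h
      rw [max_eq_right (hφnonpos x 0 (by linarith))] at hpos
      linarith [hinit x hx]
    obtain ⟨e, he, hemax⟩ : ∃ e, 0 ≤ e ∧ ∀ y ∈ Icc 0 d, ∀ s ∈ Icc 0 τ,
        v y s + e * φ y s ≤ v x t + e * φ x t := by
      rcases le_total (φ x t) 0 with h | h
      · refine ⟨0, le_rfl, fun y hy s hs => ?_⟩
        have := hmax (y, s) ⟨hy, hs⟩
        rw [max_eq_right h] at this
        have h2 : 0 ≤ ε * max (φ y s) 0 := mul_nonneg hεpos.le (le_max_right _ _)
        dsimp only at this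
        linarith
      · refine ⟨ε, hεpos.le, fun y hy s hs => ?_⟩
        have := hmax (y, s) ⟨hy, hs⟩
        rw [max_eq_left h] at this
        have h2 : ε * φ y s ≤ ε * max (φ y s) 0 :=
          mul_le_mul_of_nonneg_left (le_max_left _ _) hεpos.le
        dsimp only at this
        linarith
    have htm : t ∈ Ioc 0 τ := ⟨ht0, ht.2⟩
    obtain ⟨h1, h2⟩ := first_second_deriv_of_max_Ioo (f := fun y => v y t + e * φ y t)
      (f' := fun y => vx y t + e * (l * Real.exp (l * (y - d + d / τ * t)))) ⟨hx0, hxd⟩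
      (fun y hy => (hvx y hy t htm).add ((hφx y t).const_mul e))
      ((hvxx x ⟨hx0, hxd⟩ t htm).add ((hφxx x t).const_mul e))
      (fun y hy => hemax y (Ioo_subset_Icc_self hy) t ht)
    have h3 := HasDerivWithinAt.nonneg_of_le_left ht0 (Icc_subset_Icc_right ht.2)
      ((hvt x ⟨hx0, hxd⟩ t htm).add ((hφt x t).const_mul e).hasDerivWithinAt)
      (fun s hs => hemax x hx s ⟨hs.1, hs.2.trans ht.2⟩)
    obtain ⟨a, b, c, ha, hb, hc, hcc, hlt⟩ := hsub x ⟨hx0, hxd⟩ t htm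
    obtain ⟨E, hE⟩ : ∃ E, E = Real.exp (l * (x - d + d / τ * t)) := ⟨_, rfl⟩
    have hEpos : 0 < E := by rw [hE]; exact Real.exp_pos _
    rw [← hE] at h1 h2 h3
    have k1 : vx x t = -(e * (l * E)) := by linarith
    have k2 : a * vxx x t ≤ a * -(e * (l * l * E)) :=
      mul_le_mul_of_nonneg_left (by linarith) (ha₀.le.trans ha)
    have k3 : c * -(e * (l * (d / τ) * E)) ≤ c * vt x t :=
      mul_le_mul_of_nonneg_left (by linarith) hc
    rw [k1] at hlt
    have k4 : c * (d / τ) - a * l - b ≤ 0 := by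
      have := mul_le_mul_of_nonneg_right hcc hdτ.le
      have := mul_le_mul_of_nonneg_right ha hlpos.le
      linarith [neg_le_of_abs_le hb]
    have k5 : e * l * E * (c * (d / τ) - a * l - b) ≤ 0 :=
      mul_nonpos_of_nonneg_of_nonpos (by positivity) k4
    nlinarith
  refine ⟨ε * l, by positivity, fun x hx => ?_⟩
  have h := hmain (x, τ) ⟨hx, right_mem_Icc.2 hτ.le⟩
  have h1 : l * x ≤ φ x τ := by
    have h2 : l * (x - d + d / τ * τ) = l * x := by rw [div_mul_cancel₀ _ hτ.ne']; ring
    simp only [hφ, h2]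
    linarith [Real.add_one_le_exp (l * x)]
  have h2 : ε * (l * x) ≤ ε * max (φ x τ) 0 :=
    mul_le_mul_of_nonneg_left (h1.trans (le_max_left _ _)) hεpos.le
  dsimp only at h
  linarith

theorem abs_sub_initial_le {f f' : ℝ → ℝ} {T K t : ℝ}
    (hf : ∀ s ∈ Icc 0 T, HasDerivWithinAt f (f' s) (Icc 0 T) s)
    (hK : ∀ s ∈ Icc 0 T, |f' s| ≤ K) (ht : t ∈ Icc 0 T) : |f t - f 0| ≤ K * t := by
  have h := (convex_Icc 0 T).norm_image_sub_le_of_norm_hasDerivWithin_le hf hK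
    (left_mem_Icc.2 (ht.1.trans ht.2)) ht
  rwa [Real.norm_eq_abs, Real.norm_eq_abs, sub_zero, abs_of_nonneg ht.1] at h

theorem abs_integral_le_mul_of_bound {f : ℝ → ℝ} {T K t : ℝ}
    (hK : ∀ s ∈ Icc 0 T, |f s| ≤ K) (ht : t ∈ Icc 0 T) :
    |∫ s in (0:ℝ)..t, f s| ≤ K * t := by
  have h := intervalIntegral.norm_integral_le_of_norm_le_const (a := 0) (b := t) (C := K) (f := f)
    (fun s hs => by
      rw [uIoc_of_le ht.1] at hs
      exact hK s ⟨hs.1.le, hs.2.trans ht.2⟩)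
  rwa [Real.norm_eq_abs, sub_zero, abs_of_nonneg ht.1] at h

theorem pressure_gradient_lower_bound {n η : ℝ → ℝ} {nd D γ p P x : ℝ} (hγ : 1 < γ) (hp : 0 < p)
    (hn : HasDerivAt n nd x) (hη : HasDerivAt η D x)
    (hP : HasDerivAt (fun y => n y ^ γ / η y ^ γ) P x)
    (hnpos : 0 < n x) (hslope : p * n x ≤ nd) (hη1 : 1 / 2 ≤ η x) (hη2 : η x ≤ 2)
    (hD : |D| ≤ p / 16) : 7 / 8 * (γ * p * n x ^ γ / 2 ^ γ) ≤ P := by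
  have hηpos : 0 < η x := by linarith
  have hηγ : 0 < η x ^ γ := Real.rpow_pos_of_pos hηpos γ
  have h := (hn.rpow_const (p := γ) (Or.inl hnpos.ne')).div
    (hη.rpow_const (p := γ) (Or.inl hηpos.ne')) hηγ.ne'
  have hPeq := hP.unique h
  have e1 : n x ^ (γ - 1) = n x ^ γ / n x := by rw [Real.rpow_sub_one hnpos.ne']
  have e2 : η x ^ (γ - 1) = η x ^ γ / η x := by rw [Real.rpow_sub_one hηpos.ne']
  have hN : 0 < n x ^ γ := Real.rpow_pos_of_pos hnpos γ
  rw [e1, e2] at hPeq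
  have hP' : P = γ * n x ^ γ / η x ^ γ * (nd / n x - D / η x) := by
    rw [hPeq]; field_simp
  have h1 : p ≤ nd / n x := by rwa [le_div_iff₀ hnpos]
  have h2 : D / η x ≤ p / 8 := by
    rw [div_le_iff₀ hηpos]
    nlinarith [le_of_abs_le hD]
  have h3 : η x ^ γ ≤ 2 ^ γ := Real.rpow_le_rpow hηpos.le hη2 (by linarith)
  have h4 : γ * n x ^ γ / 2 ^ γ ≤ γ * n x ^ γ / η x ^ γ :=
    div_le_div_of_nonneg_left (by positivity) hηγ h3
  calc 7 / 8 * (γ * p * n x ^ γ / 2 ^ γ) = γ * n x ^ γ / 2 ^ γ * (7 / 8 * p) := by ring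
    _ ≤ γ * n x ^ γ / η x ^ γ * (nd / n x - D / η x) :=
      mul_le_mul h4 (by linarith) (by positivity) (by positivity)
    _ = P := hP'.symm

theorem viscous_flux_deriv_form {μ n η w : ℝ → ℝ} {μ' nd D W V B L m x : ℝ} (hB : 0 < B)
    (hμ : HasDerivAt μ μ' (n x / η x)) (hn : HasDerivAt n nd x) (hη : HasDerivAt η D x)
    (hw : HasDerivAt w W x) (hV : HasDerivAt (fun y => μ (n y / η y) * w y / η y) V x)
    (hμlow : B⁻¹ ≤ μ (n x / η x)) (hμup : μ (n x / η x) ≤ B) (hμ' : |μ'| ≤ L)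
    (hn0 : 0 ≤ n x) (hnm : n x ≤ m) (hnd : |nd| ≤ m)
    (hη1 : 1 / 2 ≤ η x) (hη2 : η x ≤ 2) (hD : |D| ≤ 1) :
    ∃ a b : ℝ, B⁻¹ / 2 ≤ a ∧ |b| ≤ L * (12 * m) * 2 + 4 * B ∧ V = a * W + b * w x := by
  have hηpos : 0 < η x := by linarith
  have hBinv : 0 < B⁻¹ := inv_pos.2 hB
  have hm : 0 ≤ m := hn0.trans hnm
  have hL : 0 ≤ L := (abs_nonneg _).trans hμ'
  have hμpos : 0 < μ (n x / η x) := hBinv.trans_le hμlow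
  have hq := hn.div hη hηpos.ne'
  have h := ((hμ.comp x hq).mul hw).div hη hηpos.ne'
  have hVeq := hV.unique h
  have hinv : (η x)⁻¹ ≤ 2 := by
    rw [inv_le_comm₀ hηpos (by norm_num)]; linarith
  have hsq : (η x ^ 2)⁻¹ ≤ 4 := by
    rw [inv_le_comm₀ (by positivity) (by norm_num)]; nlinarith
  obtain ⟨q, hqd⟩ : ∃ q, q = (nd * η x - n x * D) / η x ^ 2 := ⟨_, rfl⟩
  have hqb : |q| ≤ 12 * m := by
    rw [hqd, abs_div, abs_of_pos (pow_pos hηpos 2), div_eq_mul_inv]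
    have h1 : |nd * η x - n x * D| ≤ 3 * m := by
      calc |nd * η x - n x * D| ≤ |nd * η x| + |n x * D| := abs_sub _ _
        _ = |nd| * η x + n x * |D| := by
          rw [abs_mul, abs_mul, abs_of_pos hηpos, abs_of_nonneg hn0]
        _ ≤ m * 2 + m * 1 := by gcongr
        _ = 3 * m := by ring
    calc |nd * η x - n x * D| * (η x ^ 2)⁻¹ ≤ 3 * m * 4 := by gcongr
      _ = 12 * m := by ring
  refine ⟨μ (n x / η x) / η x, μ' * q * (η x)⁻¹ - μ (n x / η x) * D * (η x ^ 2)⁻¹, ?_, ?_, ?_⟩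
  · rw [le_div_iff₀ hηpos]; nlinarith
  · calc |μ' * q * (η x)⁻¹ - μ (n x / η x) * D * (η x ^ 2)⁻¹|
        ≤ |μ' * q * (η x)⁻¹| + |μ (n x / η x) * D * (η x ^ 2)⁻¹| := abs_sub _ _
      _ = |μ'| * |q| * (η x)⁻¹ + μ (n x / η x) * |D| * (η x ^ 2)⁻¹ := by
        simp only [abs_mul, abs_inv, abs_pow, abs_of_pos hηpos, abs_of_pos hμpos]
      _ ≤ L * (12 * m) * 2 + B * 1 * 4 := by gcongr
      _ = L * (12 * m) * 2 + 4 * B := by ring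
  · rw [hVeq, hqd]
    simp only [Function.comp, Pi.div_apply, Pi.mul_apply]
    field_simp
    ring

theorem not_isLagrangianSolution_of_left_end
    {γ B m M : ℝ} (hγ : 1 < γ) (hB : 0 < B) (hM : 0 < M)
    {μ μd ρ0 n0 u0 w0 : ℝ → ℝ}
    (hμ : ∀ s, HasDerivAt μ (μd s) s) (hμdcont : Continuous μd)
    (hμbd : ∀ s, B⁻¹ ≤ μ s ∧ μ s ≤ B) {n0d : ℝ → ℝ}
    (hn0d : ∀ x ∈ Ioo (0:ℝ) 1, HasDerivAt n0 (n0d x) x)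
    (hbound : ∀ x ∈ Ioo (0:ℝ) 1, n0 x ≤ m ∧ |n0d x| ≤ m ∧ |u0 x| ≤ M ∧ |w0 x| ≤ M)
    {p0 d0 : ℝ} (hp0 : 0 < p0) (hd0 : d0 ∈ Ioo (0:ℝ) 1)
    (hpos : ∀ x ∈ Ioo (0:ℝ) d0, 0 < ρ0 x ∧ 0 < n0 x)
    (hslope : ∀ x ∈ Ioo (0:ℝ) d0, p0 ≤ n0d x / n0 x)
    (hw0 : w0 d0 < 0) (hw0' : ∀ x ∈ Ioc (0:ℝ) d0, w0 x ≤ 0)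
    (hratio : ∀ x ∈ Ioo (0:ℝ) d0, (2:ℝ) ^ (γ + 4) * M / (γ * p0) ≤ n0 x ^ γ / ρ0 x)
    {T : ℝ} (hT : 0 < T) {v1 v2 : ℝ → ℝ → ℝ} :
    ¬ IsLagrangianSolution γ μ ρ0 n0 u0 w0 T v1 v2 := by
  rintro ⟨v1t, v2t, v1x, v2x, v1xx, v2xx, η1x, η2x, hder, hcv1, hcv2, hcv1t, hcv2t, hcv1x, hcv2x,
    -, hcv2xx, hflow, heq, hbc, hic⟩
  obtain ⟨K₀, hK₀⟩ := (isCompact_Icc.prod isCompact_Icc).exists_bound_of_continuousOn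
    (hcv1t.prodMk (hcv2t.prodMk (hcv1x.prodMk (hcv2x.prodMk hcv2xx))))
  obtain ⟨K, hKpos, hK⟩ : ∃ K, 0 < K ∧ ∀ x ∈ Icc (0:ℝ) 1, ∀ t ∈ Icc (0:ℝ) T,
      |v1t x t| ≤ K ∧ |v2t x t| ≤ K ∧ |v1x x t| ≤ K ∧ |v2x x t| ≤ K ∧ |v2xx x t| ≤ K := by
    refine ⟨|K₀| + 1, by positivity, fun x hx t ht => ?_⟩
    have h := (hK₀ (x, t) ⟨hx, ht⟩).trans ((le_abs_self K₀).trans (lt_add_one |K₀|).le)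
    simpa only [Prod.norm_def, sup_le_iff, Real.norm_eq_abs] using h
  obtain ⟨δ, hδpos, hδ⟩ : ∃ δ, 0 < δ ∧ w0 d0 = -(2 * δ) := ⟨-w0 d0 / 2, by linarith, by ring⟩
  obtain ⟨τ, hτ, hτT, hτ1, hτM, hτp, hτδ⟩ : ∃ τ, 0 < τ ∧ τ ≤ T ∧ K * τ ≤ 1 / 2 ∧ K * τ ≤ M ∧
      K * τ ≤ p0 / 16 ∧ K * τ ≤ δ := by
    obtain ⟨q, hq⟩ : ∃ q, q = min (min (1 / 2) M) (min (p0 / 16) δ) := ⟨_, rfl⟩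
    have hqpos : 0 < q := by rw [hq]; positivity
    have hle : K * min T (q / K) ≤ q :=
      (mul_le_mul_of_nonneg_left (min_le_right _ _) hKpos.le).trans_eq (mul_div_cancel₀ _ hKpos.ne')
    refine ⟨min T (q / K), by positivity, min_le_left _ _, ?_, ?_, ?_, ?_⟩ <;>
      refine hle.trans ?_ <;> simp [hq]
  have hKt : ∀ t ∈ Icc 0 τ, K * t ≤ K * τ := fun t ht => mul_le_mul_of_nonneg_left ht.2 hKpos.le
  have hsubT : Icc 0 τ ⊆ Icc 0 T := Icc_subset_Icc_right hτT
  have hsubd : Icc 0 d0 ⊆ Icc 0 1 := Icc_subset_Icc_right hd0.2.le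
  have hsubd' : Ioo 0 d0 ⊆ Ioo 0 1 := Ioo_subset_Ioo_right hd0.2.le
  have hv1t : ∀ x ∈ Icc (0:ℝ) 1, ∀ t ∈ Icc (0:ℝ) T, |v1 x t - u0 x| ≤ K * t := fun x hx t ht => by
    rw [← (hic x hx).1]
    exact abs_sub_initial_le (fun s hs => (hder x hx s hs).1) (fun s hs => (hK x hx s hs).1) ht
  have hv2t : ∀ x ∈ Icc (0:ℝ) 1, ∀ t ∈ Icc (0:ℝ) T, |v2 x t - w0 x| ≤ K * t := fun x hx t ht => by
    rw [← (hic x hx).2]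
    exact abs_sub_initial_le (fun s hs => (hder x hx s hs).2.1)
      (fun s hs => (hK x hx s hs).2.1) ht
  have hη1 : ∀ x ∈ Ioo (0:ℝ) 1, ∀ t ∈ Icc (0:ℝ) T,
      η1x x t = 1 + ∫ s in (0:ℝ)..t, v1x x s := fun x hx t ht =>
    ((hflow x (Ioo_subset_Icc_self hx) t ht).1.hasDerivAt (Icc_mem_nhds hx.1 hx.2)).unique
      ((hasDerivAt_id x).add (hasDerivAt_integral_of_continuousOn_rect hcv1 hcv1x
        (fun y hy s hs => (hder y hy s hs).2.2.1) ht hx))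
  have hη2 : ∀ x ∈ Ioo (0:ℝ) 1, ∀ t ∈ Icc (0:ℝ) T,
      η2x x t = 1 + ∫ s in (0:ℝ)..t, v2x x s := fun x hx t ht =>
    ((hflow x (Ioo_subset_Icc_self hx) t ht).2.1.hasDerivAt (Icc_mem_nhds hx.1 hx.2)).unique
      ((hasDerivAt_id x).add (hasDerivAt_integral_of_continuousOn_rect hcv2 hcv2x
        (fun y hy s hs => (hder y hy s hs).2.2.2.1) ht hx))
  have hη2' : ∀ x ∈ Ioo (0:ℝ) 1, ∀ t ∈ Icc (0:ℝ) T,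
      HasDerivAt (fun y => η2x y t) (∫ s in (0:ℝ)..t, v2xx x s) x := fun x hx t ht => by
    refine ((hasDerivAt_integral_of_continuousOn_rect hcv2x hcv2xx
      (fun y hy s hs => (hder y hy s hs).2.2.2.2.2) ht hx).const_add 1).congr_of_eventuallyEq ?_
    filter_upwards [Ioo_mem_nhds hx.1 hx.2] with y hy using hη2 y hy t ht
  have hv200 : v2 0 0 ≤ 0 := by
    have hc : ContinuousOn (fun y => v2 y 0) (Icc 0 1) := fun y hy =>
      (hder y hy 0 ⟨le_rfl, hT.le⟩).2.2.2.1.continuousWithinAt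
    have hc0 : ContinuousWithinAt (fun y => v2 y 0) (Ioo 0 d0) 0 :=
      (hc 0 (left_mem_Icc.2 zero_le_one)).mono (Ioo_subset_Icc_self.trans hsubd)
    refine closure_minimal (s := Iic (0:ℝ)) subset_rfl isClosed_Iic
      (closure_mono ?_ (hc0.mem_closure_image ?_))
    · rintro _ ⟨y, hy, rfl⟩
      simp only [(hic y (hsubd (Ioo_subset_Icc_self hy))).2]
      exact hw0' y ⟨hy.1, hy.2.le⟩
    · rw [closure_Ioo hd0.1.ne]; exact left_mem_Icc.2 hd0.1.le
  obtain ⟨L, hL⟩ := (isCompact_Icc (a := (0:ℝ)) (b := 2 * m)).exists_bound_of_continuousOn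
    hμdcont.continuousOn
  suffices h : ∃ k > 0, ∀ x ∈ Icc 0 d0, v2 x τ ≤ -k * x by
    obtain ⟨k, hkpos, hk⟩ := h
    have h0 := hbc τ ⟨hτ, hτT⟩
    have hx0 := (hder 0 (left_mem_Icc.2 zero_le_one) τ ⟨hτ.le, hτT⟩).2.2.2.1
    have h := HasDerivWithinAt.nonpos_of_le_right hd0.1 hsubd
      (hx0.add (((hasDerivAt_id (0:ℝ)).const_mul k).hasDerivWithinAt))
      (fun y hy => by
        have := hk y hy
        simp only [Pi.add_apply, id, h0.1]
        linarith)
    rw [h0.2.2.1] at h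
    linarith
  refine exists_linear_bound_of_parabolic_subsolution
    (v := v2) (vt := v2t) (vx := v2x) (vxx := v2xx) (a₀ := B⁻¹ / 2)
    (b₀ := L * (12 * m) * 2 + 4 * B) (c₀ := m) hd0.1 hτ (by positivity) hδpos
    (hcv2.mono (prod_mono hsubd hsubT))
    (fun x hx t ht => (hder x (Ioo_subset_Icc_self (hsubd' hx)) t
      (hsubT (Ioc_subset_Icc_self ht))).2.1.mono hsubT)
    (fun x hx t ht => (hder x (Ioo_subset_Icc_self (hsubd' hx)) t
      (hsubT (Ioc_subset_Icc_self ht))).2.2.2.1.hasDerivAt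
        (Icc_mem_nhds (hsubd' hx).1 (hsubd' hx).2))
    (fun x hx t ht => (hder x (Ioo_subset_Icc_self (hsubd' hx)) t
      (hsubT (Ioc_subset_Icc_self ht))).2.2.2.2.2.hasDerivAt
        (Icc_mem_nhds (hsubd' hx).1 (hsubd' hx).2))
    ?_ ?_ ?_ ?_
  · intro x hx t ht
    have hx1 := hsubd' hx
    have hxc := Ioo_subset_Icc_self hx1
    have htT := hsubT (Ioc_subset_Icc_self ht)
    have hxn : Icc (0:ℝ) 1 ∈ nhds x := Icc_mem_nhds hx1.1 hx1.2
    have hKtt := hKt t (Ioc_subset_Icc_self ht)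
    obtain ⟨-, Px, Vx, hP, hV, hmom⟩ := heq x hx1 t ⟨ht.1, htT.2⟩
    obtain ⟨hρ, hn⟩ := hpos x hx
    obtain ⟨hnm, hndm, hu0M, hw0M⟩ := hbound x hx1
    have b1 : |η1x x t - 1| ≤ 1 / 2 := by
      rw [hη1 x hx1 t htT, add_sub_cancel_left]
      exact (abs_integral_le_mul_of_bound (fun s hs => (hK x hxc s hs).2.2.1) htT).trans
        (hKtt.trans hτ1)
    have b2 : |η2x x t - 1| ≤ 1 / 2 := by
      rw [hη2 x hx1 t htT, add_sub_cancel_left]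
      exact (abs_integral_le_mul_of_bound (fun s hs => (hK x hxc s hs).2.2.2.1) htT).trans
        (hKtt.trans hτ1)
    have b3 : |∫ s in (0:ℝ)..t, v2xx x s| ≤ K * τ :=
      (abs_integral_le_mul_of_bound (fun s hs => (hK x hxc s hs).2.2.2.2) htT).trans hKtt
    rw [abs_le] at b1 b2
    have hs0 : 0 ≤ n0 x / η2x x t := div_nonneg hn.le (by linarith)
    have hs2 : n0 x / η2x x t ≤ 2 * m := by
      rw [div_le_iff₀ (by linarith)]; nlinarith
    have hdn := hn0d x hx1
    have hdη := hη2' x hx1 t htT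
    obtain ⟨a, b, ha, hb, hVab⟩ := viscous_flux_deriv_form hB (hμ _) hdn hdη
      ((hder x hxc t htT).2.2.2.2.2.hasDerivAt hxn) (hV.hasDerivAt hxn) (hμbd _).1 (hμbd _).2
      (hL _ ⟨hs0, hs2⟩) hn.le hnm hndm (by linarith) (by linarith) (by linarith)
    have hPlow := pressure_gradient_lower_bound hγ hp0 hdn hdη (hP.hasDerivAt hxn) hn
      ((le_div_iff₀ hn).1 (hslope x hx)) (by linarith) (by linarith) (b3.trans hτp)
    refine ⟨a, b, n0 x, ha, hb, hn.le, hnm, ?_⟩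
    have hr0 : 0 ≤ η2x x t / η1x x t := div_nonneg (by linarith) (by linarith)
    have hr3 : η2x x t / η1x x t ≤ 3 := by
      rw [div_le_iff₀ (by linarith)]; linarith
    have hdiff : v1 x t - v2 x t ≤ 4 * M := by
      have h1 := le_of_abs_le (hv1t x hxc t htT)
      have h2 := neg_le_of_abs_le (hv2t x hxc t htT)
      have h3 := le_of_abs_le hu0M
      have h4 := neg_le_of_abs_le hw0M
      linarith
    have hdrag : ρ0 x * (η2x x t / η1x x t) * (v1 x t - v2 x t) ≤ 12 * (ρ0 x * M) := by
      calc ρ0 x * (η2x x t / η1x x t) * (v1 x t - v2 x t)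
          ≤ ρ0 x * (η2x x t / η1x x t) * (4 * M) :=
            mul_le_mul_of_nonneg_left hdiff (mul_nonneg hρ.le hr0)
        _ ≤ ρ0 x * 3 * (4 * M) := by gcongr
        _ = 12 * (ρ0 x * M) := by ring
    have hpress : 16 * (ρ0 x * M) ≤ γ * p0 * n0 x ^ γ / 2 ^ γ := by
      have h := hratio x hx
      have h2 : (2:ℝ) ^ (γ + 4) = 2 ^ γ * 16 := by
        rw [Real.rpow_add two_pos]; norm_num
      rw [div_le_div_iff₀ (by positivity) hρ, h2] at h
      rw [le_div_iff₀ (by positivity)]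
      linarith
    have hρM : 0 < ρ0 x * M := mul_pos hρ hM
    linarith
  · intro t ht
    rcases ht.1.eq_or_lt with h | h
    · subst h
      exact hv200
    · exact (hbc t ⟨h, ht.2.trans hτT⟩).1.le
  · intro x hx
    rcases hx.1.eq_or_lt with h | h
    · subst h
      exact hv200
    · rw [(hic x (hsubd hx)).2]; exact hw0' x ⟨h, hx.2⟩
  · intro t ht
    have := le_of_abs_le (hv2t d0 ⟨hd0.1.le, hd0.2.le⟩ t (hsubT ht))
    linarith [hKt t ht]

theorem one_sub_mem_Icc_zero_one {x : ℝ} (hx : x ∈ Icc (0:ℝ) 1) : 1 - x ∈ Icc (0:ℝ) 1 :=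
  ⟨by linarith [hx.2], by linarith [hx.1]⟩

theorem hasDerivWithinAt_reflect_Icc {f : ℝ → ℝ} {c x : ℝ}
    (hf : HasDerivWithinAt f c (Icc 0 1) (1 - x)) :
    HasDerivWithinAt (fun y => f (1 - y)) (-c) (Icc 0 1) x := by
  have h := hf.scomp x (((hasDerivAt_id x).const_sub 1).hasDerivWithinAt (s := Icc (0:ℝ) 1))
    fun _ hy => one_sub_mem_Icc_zero_one hy
  simpa [Function.comp_def] using h

theorem continuousOn_reflect_rect {f : ℝ → ℝ → ℝ} {T : ℝ}
    (hf : ContinuousOn (fun p : ℝ × ℝ => f p.1 p.2) (Icc 0 1 ×ˢ Icc 0 T)) :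
    ContinuousOn (fun p : ℝ × ℝ => f (1 - p.1) p.2) (Icc 0 1 ×ˢ Icc 0 T) :=
  hf.comp (f := fun p : ℝ × ℝ => (1 - p.1, p.2)) (by fun_prop)
    fun _ hp => ⟨one_sub_mem_Icc_zero_one hp.1, hp.2⟩

/-- The problem is invariant under the reflection `x ↦ 1 - x`, `v ↦ -v`. -/
theorem IsLagrangianSolution.reflect {γ T : ℝ} {μ ρ0 n0 u0 w0 : ℝ → ℝ} {v1 v2 : ℝ → ℝ → ℝ}
    (h : IsLagrangianSolution γ μ ρ0 n0 u0 w0 T v1 v2) :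
    IsLagrangianSolution γ μ (fun x => ρ0 (1 - x)) (fun x => n0 (1 - x)) (fun x => -u0 (1 - x))
      (fun x => -w0 (1 - x)) T (fun x t => -v1 (1 - x) t) (fun x t => -v2 (1 - x) t) := by
  obtain ⟨v1t, v2t, v1x, v2x, v1xx, v2xx, η1x, η2x, hder, hcv1, hcv2, hcv1t, hcv2t, hcv1x, hcv2x,
    hcv1xx, hcv2xx, hflow, heq, hbc, hic⟩ := h
  refine ⟨fun x t => -v1t (1 - x) t, fun x t => -v2t (1 - x) t, fun x t => v1x (1 - x) t,
    fun x t => v2x (1 - x) t, fun x t => -v1xx (1 - x) t, fun x t => -v2xx (1 - x) t,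
    fun x t => η1x (1 - x) t, fun x t => η2x (1 - x) t, ?_,
    (continuousOn_reflect_rect hcv1).neg, (continuousOn_reflect_rect hcv2).neg,
    (continuousOn_reflect_rect hcv1t).neg, (continuousOn_reflect_rect hcv2t).neg,
    continuousOn_reflect_rect hcv1x, continuousOn_reflect_rect hcv2x,
    (continuousOn_reflect_rect hcv1xx).neg, (continuousOn_reflect_rect hcv2xx).neg,
    ?_, ?_, ?_, ?_⟩
  · intro x hx t ht
    obtain ⟨h1, h2, h3, h4, h5, h6⟩ := hder (1 - x) (one_sub_mem_Icc_zero_one hx) t ht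
    exact ⟨h1.neg, h2.neg,
      (hasDerivWithinAt_reflect_Icc h3).neg.congr_deriv (neg_neg _),
      (hasDerivWithinAt_reflect_Icc h4).neg.congr_deriv (neg_neg _),
      hasDerivWithinAt_reflect_Icc (f := fun y => v1x y t) h5,
      hasDerivWithinAt_reflect_Icc (f := fun y => v2x y t) h6⟩
  · intro x hx t ht
    obtain ⟨h1, h2, h3, h4⟩ := hflow (1 - x) (one_sub_mem_Icc_zero_one hx) t ht
    have key : ∀ {v : ℝ → ℝ → ℝ} {c : ℝ},
        HasDerivWithinAt (fun y => y + ∫ s in (0:ℝ)..t, v y s) c (Icc 0 1) (1 - x) →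
        HasDerivWithinAt (fun y => y + ∫ s in (0:ℝ)..t, -v (1 - y) s) c (Icc 0 1) x := by
      intro v c hv
      have hr := ((hasDerivWithinAt_reflect_Icc hv).const_sub 1).congr_deriv (neg_neg c)
      refine hr.congr_of_mem (fun y _ => ?_) hx
      rw [intervalIntegral.integral_neg]
      ring
    exact ⟨key h1, key h2, h3, h4⟩
  · intro x hx t ht
    obtain ⟨h1, P, V, hP, hV, hmom⟩ := heq (1 - x) ⟨by linarith [hx.2], by linarith [hx.1]⟩ t ht
    refine ⟨by linarith, -P, -V, hasDerivWithinAt_reflect_Icc hP,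
      hasDerivWithinAt_reflect_Icc hV, by linarith⟩
  · intro t ht
    obtain ⟨h1, h2, h3, h4⟩ := hbc t ht
    simp [h1, h2, h3, h4]
  · intro x hx
    obtain ⟨h1, h2⟩ := hic (1 - x) (one_sub_mem_Icc_zero_one hx)
    simp [h1, h2]

/-- Theorem 1, case Ω₁ = Ω₂ (Lagrangian formulation): if near one end of the common
    support both densities are positive, `n0` has a logarithmic slope bounded away from
    zero, `w0` has the indicated sign, and the ratio `n0^γ/ρ0` is at least
    `2^(γ+4) M / (γ p0)`, then for every `T > 0` the Lagrangian two-phase problem admits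
    no classical solution on `[0,1] × [0,T]`. -/
theorem nonexistence_classical_solution_equal_supports
    (γ B m M : ℝ) (hγ : 1 < γ) (hB : 0 < B) (hm : 0 < m) (hM : 0 < M)
    (μ μd ρ0 n0 u0 w0 : ℝ → ℝ)
    (hμ : ∀ s, HasDerivAt μ (μd s) s) (hμdcont : Continuous μd)
    (hμbd : ∀ s, B⁻¹ ≤ μ s ∧ μ s ≤ B ∧ μd s ≤ B)
    (hρ0cont : Continuous ρ0) (hn0cont : Continuous n0)
    (hρ0nn : ∀ x, 0 ≤ ρ0 x) (hn0nn : ∀ x, 0 ≤ n0 x)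
    (hρ0supp : ∀ x, x ∉ Set.Icc (0:ℝ) 1 → ρ0 x = 0)
    (hn0supp : ∀ x, x ∉ Set.Icc (0:ℝ) 1 → n0 x = 0)
    (n0d : ℝ → ℝ) (hn0d : ∀ x ∈ Set.Ioo (0:ℝ) 1, HasDerivAt n0 (n0d x) x)
    (hn0dcont : ContinuousOn n0d (Set.Ioo 0 1))
    (u0d u0dd w0d w0dd : ℝ → ℝ)
    (hu0d : ∀ x, HasDerivAt u0 (u0d x) x) (hu0dd : ∀ x, HasDerivAt u0d (u0dd x) x)
    (hw0d : ∀ x, HasDerivAt w0 (w0d x) x) (hw0dd : ∀ x, HasDerivAt w0d (w0dd x) x)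
    (hu0ddcont : Continuous u0dd) (hw0ddcont : Continuous w0dd)
    (hbound : ∀ x ∈ Set.Ioo (0:ℝ) 1,
      ρ0 x + n0 x + |n0d x| < m ∧
      |u0 x| < M ∧ |u0d x| < M ∧ |u0dd x| < M ∧
      |w0 x| < M ∧ |w0d x| < M ∧ |w0dd x| < M)
    (p0 d0 : ℝ) (hp0 : 0 < p0) (hd0 : d0 ∈ Set.Ioo (0:ℝ) 1)
    (hcase :
      ((∀ x ∈ Set.Ioo (0:ℝ) d0, 0 < ρ0 x ∧ 0 < n0 x) ∧
       (∀ x ∈ Set.Ioc (0:ℝ) d0, p0 ≤ n0d x / n0 x) ∧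
       w0 d0 < 0 ∧ (∀ x ∈ Set.Ioc (0:ℝ) d0, w0 x ≤ 0) ∧
       (∀ x ∈ Set.Ioo (0:ℝ) d0, (2:ℝ)^(γ+4) * M / (γ * p0) ≤ n0 x ^ γ / ρ0 x)) ∨
      ((∀ x ∈ Set.Ioo (1-d0) 1, 0 < ρ0 x ∧ 0 < n0 x) ∧
       (∀ x ∈ Set.Ico (1-d0) 1, n0d x / n0 x ≤ -p0) ∧
       0 < w0 (1-d0) ∧ (∀ x ∈ Set.Ico (1-d0) 1, 0 ≤ w0 x) ∧
       (∀ x ∈ Set.Ioo (1-d0) 1, (2:ℝ)^(γ+4) * M / (γ * p0) ≤ n0 x ^ γ / ρ0 x))) :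
    ∀ T > (0:ℝ), ¬ ∃ v1 v2 : ℝ → ℝ → ℝ, IsLagrangianSolution γ μ ρ0 n0 u0 w0 T v1 v2 := by
  rintro T hT ⟨v1, v2, hsol⟩
  rcases hcase with ⟨hpos, hslope, hw, hw', hratio⟩ | ⟨hpos, hslope, hw, hw', hratio⟩
  · refine not_isLagrangianSolution_of_left_end (m := m) hγ hB hM hμ hμdcont
      (fun s => ⟨(hμbd s).1, (hμbd s).2.1⟩) hn0d (fun x hx => ?_) hp0 hd0 hpos
      (fun x hx => hslope x (Ioo_subset_Ioc_self hx)) hw hw' hratio hT hsol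
    obtain ⟨h1, h2, -, -, h3, -⟩ := hbound x hx
    exact ⟨by linarith [hρ0nn x, abs_nonneg (n0d x)], by linarith [hρ0nn x, hn0nn x], h2.le, h3.le⟩
  · refine not_isLagrangianSolution_of_left_end (m := m) (ρ0 := fun x => ρ0 (1 - x))
      (n0 := fun x => n0 (1 - x)) (w0 := fun x => -w0 (1 - x)) (u0 := fun x => -u0 (1 - x))
      (n0d := fun x => -n0d (1 - x))
      hγ hB hM hμ hμdcont (fun s => ⟨(hμbd s).1, (hμbd s).2.1⟩) (fun x hx => ?_) (fun x hx => ?_)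
      hp0 hd0 (fun x hx => hpos (1 - x) ⟨by linarith [hx.2], by linarith [hx.1]⟩)
      (fun x hx => ?_) (neg_lt_zero.2 hw) (fun x hx => neg_nonpos.2 (hw' (1 - x)
        ⟨by linarith [hx.2], by linarith [hx.1]⟩))
      (fun x hx => hratio (1 - x) ⟨by linarith [hx.2], by linarith [hx.1]⟩) hT hsol.reflect
    · have h := (hn0d (1 - x) ⟨by linarith [hx.2], by linarith [hx.1]⟩).scomp x
        ((hasDerivAt_id x).const_sub 1)
      simpa [Function.comp_def] using h
    · obtain ⟨h1, h2, -, -, h3, -⟩ := hbound (1 - x) ⟨by linarith [hx.2], by linarith [hx.1]⟩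
      simp only [abs_neg]
      exact ⟨by linarith [hρ0nn (1 - x), abs_nonneg (n0d (1 - x))],
        by linarith [hρ0nn (1 - x), hn0nn (1 - x)], h2.le, h3.le⟩
    · have h := hslope (1 - x) ⟨by linarith [hx.2], by linarith [hx.1]⟩
      simp only [neg_div]
      linarith
end

section
/- Non-existence of classical solutions when the Navier–Stokes density vanishes near a boundary point of the common support (Theorem 2, case Ω₂ ⫋ Ω₁, Lagrangian formulation): Suppose there exists d0 ∈ (0,1) such that either (i) n0 = 0 on (0,d0), ρ0 > 0 on (0,d0), w0(d0) < 0, and u0(x) − w0(x) < 0 for all x ∈ (0,d0]; or (ii) n0 = 0 on (1−d0,1), ρ0 > 0 on (1−d0,1), w0(1−d0) > 0, and u0(x) − w0(x) > 0 for all x ∈ [1−d0,1). Then for every T > 0 there exists no classical solution of the Lagrangian two-phase problem on [0,1] × [0,T]. -/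
open Set MeasureTheory

/-- If `v` and `∂ₓv` are continuous on `[0,1] × [0,T]`, the spatial derivative of the flow map
`x + ∫₀ᵗ v(x,s) ds` at an interior point tends to `1` as `t → 0⁺`. -/
theorem tendsto_flow_spatial_deriv {T : ℝ} (hT : 0 < T) {v vx ηx : ℝ → ℝ → ℝ}
    (hv : ContinuousOn (fun p : ℝ × ℝ => v p.1 p.2) (Icc 0 1 ×ˢ Icc 0 T))
    (hvx : ContinuousOn (fun p : ℝ × ℝ => vx p.1 p.2) (Icc 0 1 ×ˢ Icc 0 T))
    (hd : ∀ x ∈ Icc (0:ℝ) 1, ∀ t ∈ Icc (0:ℝ) T,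
      HasDerivWithinAt (fun y => v y t) (vx x t) (Icc 0 1) x)
    (hη : ∀ x ∈ Icc (0:ℝ) 1, ∀ t ∈ Icc (0:ℝ) T,
      HasDerivWithinAt (fun y => y + ∫ s in (0:ℝ)..t, v y s) (ηx x t) (Icc 0 1) x)
    {x : ℝ} (hx : x ∈ Ioo (0:ℝ) 1) :
    Filter.Tendsto (fun t => ηx x t) (nhdsWithin 0 (Ioc 0 T)) (nhds 1) := by
  obtain ⟨K, hK⟩ := (isCompact_Icc.prod isCompact_Icc).exists_bound_of_continuousOn hvx
  have hK0 : 0 ≤ K := (norm_nonneg _).trans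
    (hK (x, 0) ⟨Ioo_subset_Icc_self hx, left_mem_Icc.2 hT.le⟩)
  have hlip : ∀ t ∈ Icc (0:ℝ) T, ∀ y ∈ Icc (0:ℝ) 1, ∀ z ∈ Icc (0:ℝ) 1,
      ‖v z t - v y t‖ ≤ K * ‖z - y‖ := fun t ht y hy z hz =>
    (convex_Icc (0:ℝ) 1).norm_image_sub_le_of_norm_hasDerivWithin_le
      (fun w hw => hd w hw t ht) (fun w hw => hK (w, t) ⟨hw, ht⟩) hy hz
  have hint : ∀ t ∈ Icc (0:ℝ) T, ∀ y ∈ Icc (0:ℝ) 1,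
      IntervalIntegrable (fun s => v y s) volume 0 t := by
    intro t ht y hy
    refine ContinuousOn.intervalIntegrable ?_
    rw [uIcc_of_le ht.1]
    exact hv.comp (f := fun s : ℝ => (y, s)) (by fun_prop)
      fun s hs => ⟨hy, hs.1, hs.2.trans ht.2⟩
  have hbound : ∀ t ∈ Icc (0:ℝ) T, ‖ηx x t - 1‖ ≤ K * t := by
    intro t ht
    have hder : HasDerivAt (fun y => ∫ s in (0:ℝ)..t, v y s) (ηx x t - 1) x := by
      have h := ((hη x (Ioo_subset_Icc_self hx) t ht).hasDerivAt
        (Icc_mem_nhds hx.1 hx.2)).sub (hasDerivAt_id x)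
      exact h.congr_of_eventuallyEq (Filter.Eventually.of_forall fun y => by simp)
    have hL : LipschitzOnWith (K * t).toNNReal (fun y => ∫ s in (0:ℝ)..t, v y s)
        (Icc (0:ℝ) 1) := by
      refine LipschitzOnWith.of_dist_le_mul fun z hz y hy => ?_
      rw [Real.coe_toNNReal _ (mul_nonneg hK0 ht.1), dist_eq_norm, dist_eq_norm,
        ← intervalIntegral.integral_sub (hint t ht z hz) (hint t ht y hy)]
      refine (intervalIntegral.norm_integral_le_of_norm_le_const
        (C := K * ‖z - y‖) fun s hs => ?_).trans_eq ?_
      · rw [uIoc_of_le ht.1] at hs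
        exact hlip s ⟨hs.1.le, hs.2.trans ht.2⟩ y hy z hz
      · rw [sub_zero, abs_of_nonneg ht.1]
        ring
    have h := norm_deriv_le_of_lipschitzOn (Icc_mem_nhds hx.1 hx.2) hL
    rwa [hder.deriv, Real.coe_toNNReal _ (mul_nonneg hK0 ht.1)] at h
  rw [tendsto_iff_norm_sub_tendsto_zero]
  have hz : Filter.Tendsto (fun t : ℝ => K * t) (nhdsWithin 0 (Ioc 0 T)) (nhds 0) := by
    have h : Continuous fun t : ℝ => K * t := by fun_prop
    simpa using h.continuousWithinAt (s := Ioc 0 T) (x := 0) |>.tendsto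
  exact tendsto_of_tendsto_of_tendsto_of_le_of_le' tendsto_const_nhds hz
    (Filter.Eventually.of_forall fun _ => norm_nonneg _)
    (eventually_mem_nhdsWithin.mono fun t ht => hbound t (Ioc_subset_Icc_self ht))

/-- Continuity in time down to `t = 0` at a fixed point of `[0,1]`. -/
theorem tendsto_initial_of_continuousOn {T : ℝ} (hT : 0 < T) {f : ℝ → ℝ → ℝ}
    (hf : ContinuousOn (fun p : ℝ × ℝ => f p.1 p.2) (Icc 0 1 ×ˢ Icc 0 T))
    {x : ℝ} (hx : x ∈ Icc (0:ℝ) 1) :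
    Filter.Tendsto (fun t => f x t) (nhdsWithin 0 (Ioc 0 T)) (nhds (f x 0)) := by
  have h : ContinuousOn (fun t => f x t) (Icc 0 T) :=
    hf.comp (f := fun s : ℝ => (x, s)) (by fun_prop) fun s hs => ⟨hx, hs⟩
  exact (h 0 (left_mem_Icc.2 hT.le)).mono_left (nhdsWithin_mono _ Ioc_subset_Icc_self)

/-- A function vanishing for `0 < t ≤ T` and continuous up to `t = 0` vanishes at `t = 0`. -/
theorem initial_eq_zero_of_continuousOn {T : ℝ} (hT : 0 < T) {f : ℝ → ℝ → ℝ}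
    (hf : ContinuousOn (fun p : ℝ × ℝ => f p.1 p.2) (Icc 0 1 ×ˢ Icc 0 T))
    {x : ℝ} (hx : x ∈ Icc (0:ℝ) 1) (h0 : ∀ t ∈ Ioc (0:ℝ) T, f x t = 0) : f x 0 = 0 := by
  have : (nhdsWithin (0:ℝ) (Ioc 0 T)).NeBot := by
    rw [nhdsWithin_Ioc_eq_nhdsGT hT]
    infer_instance
  refine tendsto_nhds_unique (tendsto_initial_of_continuousOn hT hf hx)
    (tendsto_const_nhds.congr' ?_)
  filter_upwards [eventually_mem_nhdsWithin] with t ht using (h0 t ht).symm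

/-- Where the Navier–Stokes density vanishes, the momentum equation is an elliptic balance
between viscosity and drag, so that the sign of the initial relative velocity makes the initial
velocity gradient monotone. -/
theorem initial_velocity_gradient_le {γ T c d a b σ : ℝ} (hγ : 1 < γ) (hT : 0 < T)
    {μ ρ0 n0 : ℝ → ℝ} {v1 v2 v2x η1x η2x : ℝ → ℝ → ℝ}
    (hμ0 : 0 < μ 0) (hc : 0 ≤ c) (hd : d ≤ 1)
    (hn : ∀ x ∈ Ioo c d, n0 x = 0 ∧ 0 < ρ0 x)
    (hca : c < a) (hab : a ≤ b) (hbd : b < d)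
    (hv1 : ContinuousOn (fun p : ℝ × ℝ => v1 p.1 p.2) (Icc 0 1 ×ˢ Icc 0 T))
    (hv2 : ContinuousOn (fun p : ℝ × ℝ => v2 p.1 p.2) (Icc 0 1 ×ˢ Icc 0 T))
    (hv2x : ContinuousOn (fun p : ℝ × ℝ => v2x p.1 p.2) (Icc 0 1 ×ˢ Icc 0 T))
    (hder : ∀ x ∈ Icc (0:ℝ) 1, ∀ t ∈ Icc (0:ℝ) T,
      HasDerivWithinAt (fun y => v2 y t) (v2x x t) (Icc 0 1) x)
    (hη : ∀ x ∈ Icc (0:ℝ) 1, ∀ t ∈ Icc (0:ℝ) T,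
      HasDerivWithinAt (fun y => y + ∫ s in (0:ℝ)..t, v2 y s) (η2x x t) (Icc 0 1) x ∧
      0 < η1x x t ∧ 0 < η2x x t)
    (hmom : ∀ x ∈ Ioo (0:ℝ) 1, ∀ t ∈ Ioc (0:ℝ) T, ∃ A Px Vx : ℝ,
      HasDerivWithinAt (fun y => n0 y ^ γ / (η2x y t) ^ γ) Px (Icc 0 1) x ∧
      HasDerivWithinAt (fun y => μ (n0 y / η2x y t) * v2x y t / η2x y t) Vx (Icc 0 1) x ∧
      n0 x * A + Px = Vx + ρ0 x * (η2x x t / η1x x t) * (v1 x t - v2 x t))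
    (hσ : ∀ x ∈ Icc a b, σ * (v1 x 0 - v2 x 0) < 0) :
    σ * v2x a 0 ≤ σ * v2x b 0 := by
  have hsub : ∀ x ∈ Icc a b, x ∈ Ioo c d := fun x hx =>
    ⟨hca.trans_le hx.1, hx.2.trans_lt hbd⟩
  have hsub1 : ∀ x ∈ Icc a b, x ∈ Ioo (0:ℝ) 1 := fun x hx =>
    ⟨hc.trans_lt (hsub x hx).1, (hsub x hx).2.trans_le hd⟩
  have hsign : ∀ᶠ t in nhds (0:ℝ), ∀ x ∈ Icc a b,
      (t ∈ Icc 0 T → σ * (v1 x t - v2 x t) < 0) := by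
    refine isCompact_Icc.eventually_forall_of_forall_eventually fun x hx => ?_
    have hx1 := hsub1 x hx
    have hcont : ContinuousWithinAt (fun p : ℝ × ℝ => σ * (v1 p.1 p.2 - v2 p.1 p.2))
        (Icc 0 1 ×ˢ Icc 0 T) (x, 0) :=
      (continuousOn_const.mul (hv1.sub hv2)) (x, 0)
        ⟨Ioo_subset_Icc_self hx1, left_mem_Icc.2 hT.le⟩
    have hev := eventually_nhdsWithin_iff.1
      (hcont.eventually_lt continuousWithinAt_const (hσ x hx))
    have hswap : Filter.Tendsto Prod.swap (nhds ((0:ℝ), x)) (nhds (x, (0:ℝ))) :=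
      continuous_swap.tendsto (0, x)
    have hfst : ∀ᶠ z : ℝ × ℝ in nhds (0, x), z.2 ∈ Icc (0:ℝ) 1 :=
      continuous_snd.continuousAt.eventually (Icc_mem_nhds hx1.1 hx1.2)
    filter_upwards [hswap.eventually hev, hfst] with z hz hz1 hzt
    exact hz ⟨hz1, hzt⟩
  have hmono : ∀ᶠ t in nhdsWithin (0:ℝ) (Ioc 0 T),
      σ * (v2x a t / η2x a t) ≤ σ * (v2x b t / η2x b t) := by
    filter_upwards [hsign.filter_mono nhdsWithin_le_nhds, eventually_mem_nhdsWithin]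
      with t hneg ht
    have ht' := Ioc_subset_Icc_self ht
    have hF : ∀ x ∈ Icc a b, ∃ D, 0 ≤ D ∧
        HasDerivAt (fun y => σ * (μ (n0 y / η2x y t) * v2x y t / η2x y t)) D x := by
      intro x hx
      have hx1 := hsub1 x hx
      obtain ⟨A, Px, Vx, hP, hV, heq⟩ := hmom x hx1 t ht
      have hnhds : Icc (0:ℝ) 1 ∈ nhds x := Icc_mem_nhds hx1.1 hx1.2
      have hP0 : Px = 0 := by
        refine (hP.hasDerivAt hnhds).unique
          ((hasDerivAt_const x (0:ℝ)).congr_of_eventuallyEq ?_)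
        filter_upwards [Ioo_mem_nhds (hsub x hx).1 (hsub x hx).2] with y hy
        rw [(hn y hy).1, Real.zero_rpow (by linarith), zero_div]
      refine ⟨σ * Vx, ?_, (hV.hasDerivAt hnhds).const_mul σ⟩
      obtain ⟨-, h1, h2⟩ := hη x (Ioo_subset_Icc_self hx1) t ht'
      rw [(hn x (hsub x hx)).1, hP0, zero_mul, zero_add] at heq
      have hpos : 0 < ρ0 x * (η2x x t / η1x x t) :=
        mul_pos (hn x (hsub x hx)).2 (div_pos h2 h1)
      have hprod := mul_neg_of_pos_of_neg hpos (hneg x hx ht')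
      linear_combination hprod.le + σ * heq
    have hle : σ * (μ (n0 a / η2x a t) * v2x a t / η2x a t) ≤
        σ * (μ (n0 b / η2x b t) * v2x b t / η2x b t) := by
      refine monotoneOn_of_deriv_nonneg
        (f := fun y => σ * (μ (n0 y / η2x y t) * v2x y t / η2x y t))
        (convex_Icc a b) (fun x hx => ?_) (fun x hx => ?_)
        (fun x hx => ?_) (left_mem_Icc.2 hab) (right_mem_Icc.2 hab) hab
      · obtain ⟨D, -, hD⟩ := hF x hx
        exact hD.continuousAt.continuousWithinAt
      · obtain ⟨D, -, hD⟩ := hF x (interior_subset hx)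
        exact hD.differentiableAt.differentiableWithinAt
      · obtain ⟨D, hD0, hD⟩ := hF x (interior_subset hx)
        exact hD.deriv ▸ hD0
    rw [(hn a (hsub a (left_mem_Icc.2 hab))).1, (hn b (hsub b (right_mem_Icc.2 hab))).1,
      zero_div, zero_div] at hle
    refine le_of_mul_le_mul_left ?_ hμ0
    calc _ = σ * (μ 0 * v2x a t / η2x a t) := by ring
      _ ≤ σ * (μ 0 * v2x b t / η2x b t) := hle
      _ = _ := by ring
  have hlim : ∀ x ∈ Icc a b, Filter.Tendsto (fun t => σ * (v2x x t / η2x x t))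
      (nhdsWithin 0 (Ioc 0 T)) (nhds (σ * v2x x 0)) := by
    intro x hx
    have h := ((tendsto_initial_of_continuousOn hT hv2x
      (Ioo_subset_Icc_self (hsub1 x hx))).div
      (tendsto_flow_spatial_deriv hT hv2 hv2x hder
        (fun y hy t ht => (hη y hy t ht).1) (hsub1 x hx)) one_ne_zero).const_mul σ
    simpa using h
  have : (nhdsWithin (0:ℝ) (Ioc 0 T)).NeBot := by
    rw [nhdsWithin_Ioc_eq_nhdsGT hT]
    infer_instance
  exact le_of_tendsto_of_tendsto (hlim a (left_mem_Icc.2 hab))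
    (hlim b (right_mem_Icc.2 hab)) hmono

/-- Theorem 2, case Ω₂ ⫋ Ω₁ (Lagrangian formulation): if near one end of the common
    support the Navier–Stokes density `n0` vanishes while `ρ0 > 0`, and `w0` and
    `u0 - w0` have the indicated signs there, then for every `T > 0` the Lagrangian
    two-phase problem admits no classical solution on `[0,1] × [0,T]`. -/
theorem nonexistence_classical_solution_ns_density_vanishes
    (γ B m M : ℝ) (hγ : 1 < γ) (hB : 0 < B) (hm : 0 < m) (hM : 0 < M)
    (μ μd ρ0 n0 u0 w0 : ℝ → ℝ)
    (hμ : ∀ s, HasDerivAt μ (μd s) s) (hμdcont : Continuous μd)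
    (hμbd : ∀ s, B⁻¹ ≤ μ s ∧ μ s ≤ B ∧ μd s ≤ B)
    (hρ0cont : Continuous ρ0) (hn0cont : Continuous n0)
    (hρ0nn : ∀ x, 0 ≤ ρ0 x) (hn0nn : ∀ x, 0 ≤ n0 x)
    (hρ0supp : ∀ x, x ∉ Set.Icc (0:ℝ) 1 → ρ0 x = 0)
    (hn0supp : ∀ x, x ∉ Set.Icc (0:ℝ) 1 → n0 x = 0)
    (n0d : ℝ → ℝ) (hn0d : ∀ x ∈ Set.Ioo (0:ℝ) 1, HasDerivAt n0 (n0d x) x)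
    (hn0dcont : ContinuousOn n0d (Set.Ioo 0 1))
    (u0d u0dd w0d w0dd : ℝ → ℝ)
    (hu0d : ∀ x, HasDerivAt u0 (u0d x) x) (hu0dd : ∀ x, HasDerivAt u0d (u0dd x) x)
    (hw0d : ∀ x, HasDerivAt w0 (w0d x) x) (hw0dd : ∀ x, HasDerivAt w0d (w0dd x) x)
    (hu0ddcont : Continuous u0dd) (hw0ddcont : Continuous w0dd)
    (hbound : ∀ x ∈ Set.Ioo (0:ℝ) 1,
      ρ0 x + n0 x + |n0d x| < m ∧
      |u0 x| < M ∧ |u0d x| < M ∧ |u0dd x| < M ∧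
      |w0 x| < M ∧ |w0d x| < M ∧ |w0dd x| < M)
    (d0 : ℝ) (hd0 : d0 ∈ Set.Ioo (0:ℝ) 1)
    (hcase :
      ((∀ x ∈ Set.Ioo (0:ℝ) d0, n0 x = 0 ∧ 0 < ρ0 x) ∧
       w0 d0 < 0 ∧ (∀ x ∈ Set.Ioc (0:ℝ) d0, u0 x - w0 x < 0)) ∨
      ((∀ x ∈ Set.Ioo (1-d0) 1, n0 x = 0 ∧ 0 < ρ0 x) ∧
       0 < w0 (1-d0) ∧ (∀ x ∈ Set.Ico (1-d0) 1, 0 < u0 x - w0 x))) :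
    ∀ T > (0:ℝ), ¬ ∃ v1 v2 : ℝ → ℝ → ℝ, IsLagrangianSolution γ μ ρ0 n0 u0 w0 T v1 v2 := by
  rintro T hT ⟨v1, v2, v1t, v2t, v1x, v2x, v1xx, v2xx, η1x, η2x, hd, hv1, hv2, -, -, -, hv2x,
    -, -, hη, hmom, hbc, hic⟩
  have hμ0 : 0 < μ 0 := (inv_pos.2 hB).trans_le (hμbd 0).1
  have hder : ∀ x ∈ Icc (0:ℝ) 1, ∀ t ∈ Icc (0:ℝ) T,
      HasDerivWithinAt (fun y => v2 y t) (v2x x t) (Icc 0 1) x :=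
    fun x hx t ht => (hd x hx t ht).2.2.2.1
  have hη' : ∀ x ∈ Icc (0:ℝ) 1, ∀ t ∈ Icc (0:ℝ) T,
      HasDerivWithinAt (fun y => y + ∫ s in (0:ℝ)..t, v2 y s) (η2x x t) (Icc 0 1) x ∧
      0 < η1x x t ∧ 0 < η2x x t := fun x hx t ht => (hη x hx t ht).2
  have hmom' : ∀ x ∈ Ioo (0:ℝ) 1, ∀ t ∈ Ioc (0:ℝ) T, ∃ A Px Vx : ℝ,
      HasDerivWithinAt (fun y => n0 y ^ γ / (η2x y t) ^ γ) Px (Icc 0 1) x ∧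
      HasDerivWithinAt (fun y => μ (n0 y / η2x y t) * v2x y t / η2x y t) Vx (Icc 0 1) x ∧
      n0 x * A + Px = Vx + ρ0 x * (η2x x t / η1x x t) * (v1 x t - v2 x t) :=
    fun x hx t ht => ⟨v2t x t, (hmom x hx t ht).2⟩
  have h0 : (0:ℝ) ∈ Icc (0:ℝ) 1 := left_mem_Icc.2 zero_le_one
  have h1 : (1:ℝ) ∈ Icc (0:ℝ) 1 := right_mem_Icc.2 zero_le_one
  have hT0 : (0:ℝ) ∈ Icc (0:ℝ) T := left_mem_Icc.2 hT.le
  have hgrad : ContinuousOn (fun x => v2x x 0) (Icc 0 1) :=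
    hv2x.comp (f := fun x : ℝ => (x, (0:ℝ))) (by fun_prop) fun x hx => ⟨hx, hT0⟩
  have hvel : ContinuousOn (fun x => v2 x 0) (Icc 0 1) :=
    hv2.comp (f := fun x : ℝ => (x, (0:ℝ))) (by fun_prop) fun x hx => ⟨hx, hT0⟩
  have hderiv : ∀ x ∈ Ioo (0:ℝ) 1, HasDerivAt (fun y => v2 y 0) (v2x x 0) x := fun x hx =>
    (hder x (Ioo_subset_Icc_self hx) 0 hT0).hasDerivAt (Icc_mem_nhds hx.1 hx.2)
  have hmono : ∀ p q : ℝ, 0 ≤ p → p ≤ q → q ≤ 1 → (∀ x ∈ Ioo p q, 0 ≤ v2x x 0) →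
      v2 p 0 ≤ v2 q 0 := by
    intro p q hp hpq hq hnn
    have hsub : ∀ x ∈ interior (Icc p q), x ∈ Ioo p q ∧ x ∈ Ioo (0:ℝ) 1 := by
      intro x hx
      rw [interior_Icc] at hx
      exact ⟨hx, hp.trans_lt hx.1, hx.2.trans_le hq⟩
    refine monotoneOn_of_deriv_nonneg (convex_Icc p q) (hvel.mono (Icc_subset_Icc hp hq))
      (fun x hx => (hderiv x (hsub x hx).2).differentiableAt.differentiableWithinAt)
      (fun x hx => ?_) (left_mem_Icc.2 hpq) (right_mem_Icc.2 hpq) hpq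
    rw [(hderiv x (hsub x hx).2).deriv]
    exact hnn x (hsub x hx).1
  rcases hcase with ⟨hn, hw, hrel⟩ | ⟨hn, hw, hrel⟩
  · have hv0 : v2 0 0 = 0 := initial_eq_zero_of_continuousOn hT hv2 h0 fun t ht => (hbc t ht).1
    have hvx0 : v2x 0 0 = 0 :=
      initial_eq_zero_of_continuousOn hT hv2x h0 fun t ht => (hbc t ht).2.2.1
    have hle : v2 0 0 ≤ v2 d0 0 := by
      refine hmono 0 d0 le_rfl hd0.1.le hd0.2.le fun b hb => ?_
      have hlim : Filter.Tendsto (fun x => v2x x 0) (nhdsWithin 0 (Ioc 0 b)) (nhds 0) := by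
        have h := (hgrad 0 h0).tendsto
        rw [hvx0] at h
        exact h.mono_left (nhdsWithin_mono _ fun x hx =>
          ⟨hx.1.le, (hx.2.trans_lt hb.2).le.trans hd0.2.le⟩)
      have : (nhdsWithin (0:ℝ) (Ioc 0 b)).NeBot := by
        rw [nhdsWithin_Ioc_eq_nhdsGT hb.1]
        infer_instance
      refine le_of_tendsto hlim (eventually_mem_nhdsWithin.mono fun a ha => ?_)
      have h := initial_velocity_gradient_le (σ := 1) hγ hT hμ0 le_rfl hd0.2.le hn ha.1 ha.2
        hb.2 hv1 hv2 hv2x hder hη' hmom' fun x hx => by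
          have hx0 : 0 < x := ha.1.trans_le hx.1
          have hxd : x ≤ d0 := hx.2.trans hb.2.le
          obtain ⟨e1, e2⟩ := hic x ⟨hx0.le, hxd.trans hd0.2.le⟩
          rw [e1, e2, one_mul]
          exact hrel x ⟨hx0, hxd⟩
      simpa using h
    rw [hv0, (hic d0 (Ioo_subset_Icc_self hd0)).2] at hle
    exact hle.not_gt hw
  · have hd1 : 0 < 1 - d0 := sub_pos.2 hd0.2
    have hd2 : 1 - d0 < 1 := sub_lt_self 1 hd0.1
    have hv0 : v2 1 0 = 0 := initial_eq_zero_of_continuousOn hT hv2 h1 fun t ht => (hbc t ht).2.1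
    have hvx0 : v2x 1 0 = 0 :=
      initial_eq_zero_of_continuousOn hT hv2x h1 fun t ht => (hbc t ht).2.2.2
    have hle : v2 (1 - d0) 0 ≤ v2 1 0 := by
      refine hmono (1 - d0) 1 hd1.le hd2.le le_rfl fun a ha => ?_
      have hlim : Filter.Tendsto (fun x => v2x x 0) (nhdsWithin 1 (Ico a 1)) (nhds 0) := by
        have h := (hgrad 1 h1).tendsto
        rw [hvx0] at h
        exact h.mono_left (nhdsWithin_mono _ fun x hx =>
          ⟨hd1.le.trans (ha.1.trans_le hx.1).le, hx.2.le⟩)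
      have : (nhdsWithin (1:ℝ) (Ico a 1)).NeBot := by
        rw [nhdsWithin_Ico_eq_nhdsLT ha.2]
        infer_instance
      refine le_of_tendsto hlim ?_
      refine eventually_mem_nhdsWithin.mono fun b hb => ?_
      have h := initial_velocity_gradient_le (σ := -1) hγ hT hμ0 hd1.le le_rfl hn ha.1 hb.1
        hb.2 hv1 hv2 hv2x hder hη' hmom' fun x hx => by
          have hx0 : 1 - d0 ≤ x := ha.1.le.trans hx.1
          have hxd : x < 1 := hx.2.trans_lt hb.2
          obtain ⟨e1, e2⟩ := hic x ⟨hd1.le.trans hx0, hxd.le⟩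
          have hpos := hrel x ⟨hx0, hxd⟩
          rw [e1, e2]
          linarith
      linarith
    rw [hv0, (hic (1 - d0) ⟨hd1.le, hd2.le⟩).2] at hle
    exact hle.not_gt hw
end

section
/- Vanishing of the velocity outside the support of the densities: Let B > 0 and let a : ℝ → ℝ be continuous with 1/(2B) ≤ a(x) ≤ 2B for all x ≥ 1. Let v : ℝ → ℝ be continuously differentiable on [1,∞) such that v and v' are square-integrable on (1,∞), and such that the function x ↦ a(x) v'(x) is differentiable on (1,∞) with derivative identically equal to 0. Then v(x) = 0 for all x ≥ 1. -/
open Set MeasureTheory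

/-- A function continuous on `[a,∞)` with zero derivative on `(a,∞)` is constant on `[a,∞)`. -/
theorem eq_left_endpoint_of_hasDerivAt_zero {f : ℝ → ℝ} {a : ℝ} (hf : ContinuousOn f (Ici a))
    (hf' : ∀ x ∈ Ioi a, HasDerivAt f 0 x) {x : ℝ} (hx : a ≤ x) : f x = f a := by
  rcases hx.eq_or_lt with rfl | hlt
  · rfl
  obtain ⟨c, -, hc⟩ := exists_hasDerivAt_eq_slope f (fun _ => 0) hlt
    (hf.mono Icc_subset_Ici_self) fun y hy => hf' y hy.1
  have hne : x - a ≠ 0 := (sub_pos.2 hlt).ne'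
  field_simp at hc
  linarith

/-- An integrable function on `(a,∞)` has no positive lower bound there. -/
theorem nonpos_of_le_of_integrableOn_Ioi {f : ℝ → ℝ} {a k : ℝ} (hf : IntegrableOn f (Ioi a))
    (hk : ∀ x ∈ Ioi a, k ≤ f x) : k ≤ 0 := by
  by_contra! hpos
  have hconst : IntegrableOn (fun _ : ℝ => k) (Ioi a) :=
    Integrable.mono' hf aestronglyMeasurable_const <|
      (ae_restrict_iff' measurableSet_Ioi).2 <| .of_forall fun x hx => by
        simpa [abs_of_pos hpos] using hk x hx
  simp [integrableOn_const_iff, hpos.ne'] at hconst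

/-- Vanishing of the velocity outside the support of the densities: if `a` is continuous
    with `1/(2B) ≤ a ≤ 2B` on `[1,∞)`, `v` is continuously differentiable on `[1,∞)`,
    `v` and `v'` are square-integrable on `(1,∞)`, and `(a v')' ≡ 0` on `(1,∞)`,
    then `v ≡ 0` on `[1,∞)`. -/
theorem velocity_vanishes_outside_support
    (B : ℝ) (hB : 0 < B)
    (a : ℝ → ℝ) (hacont : Continuous a)
    (ha : ∀ x ≥ (1:ℝ), 1/(2*B) ≤ a x ∧ a x ≤ 2*B)
    (v dv : ℝ → ℝ)
    (hdv : ∀ x ∈ Set.Ici (1:ℝ), HasDerivWithinAt v (dv x) (Set.Ici 1) x)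
    (hdvcont : ContinuousOn dv (Set.Ici 1))
    (hv2 : IntegrableOn (fun x => (v x)^2) (Set.Ioi 1))
    (hdv2 : IntegrableOn (fun x => (dv x)^2) (Set.Ioi 1))
    (hflux : ∀ x ∈ Set.Ioi (1:ℝ), HasDerivAt (fun y => a y * dv y) 0 x) :
    ∀ x ≥ (1:ℝ), v x = 0 := by
  have hflux_const : ∀ x ≥ (1 : ℝ), a x * dv x = a 1 * dv 1 := fun x hx =>
    eq_left_endpoint_of_hasDerivAt_zero (f := fun y => a y * dv y)
      (hacont.continuousOn.mul hdvcont) hflux hx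
  have hflux_zero : a 1 * dv 1 = 0 := by
    have hle : (a 1 * dv 1) ^ 2 / (2 * B) ^ 2 ≤ 0 := by
      refine nonpos_of_le_of_integrableOn_Ioi hdv2 fun x hx => ?_
      have hx1 : (1 : ℝ) ≤ x := (mem_Ioi.1 hx).le
      have hapos : 0 < a x := lt_of_lt_of_le (by positivity) (ha x hx1).1
      rw [← hflux_const x hx1, div_le_iff₀ (by positivity), mul_pow, mul_comm]
      gcongr
      exact (ha x hx1).2
    by_contra hne
    have : 0 < (a 1 * dv 1) ^ 2 / (2 * B) ^ 2 := by positivity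
    linarith
  have hdv_zero : ∀ x ≥ (1 : ℝ), dv x = 0 := fun x hx =>
    (mul_eq_zero.1 ((hflux_const x hx).trans hflux_zero)).resolve_left
      (lt_of_lt_of_le (by positivity) (ha x hx).1).ne'
  have hv_const : ∀ x ≥ (1 : ℝ), v x = v 1 := fun x hx =>
    eq_left_endpoint_of_hasDerivAt_zero (fun y hy => (hdv y hy).continuousWithinAt)
      (fun y hy => by
        have hy1 : (1 : ℝ) ≤ y := (mem_Ioi.1 hy).le
        simpa [hdv_zero y hy1] using (hdv y hy1).hasDerivAt (Ici_mem_nhds hy)) hx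
  have hle : v 1 ^ 2 ≤ 0 := nonpos_of_le_of_integrableOn_Ioi hv2 fun x hx => by
    rw [hv_const x (mem_Ioi.1 hx).le]
  intro x hx
  rw [hv_const x hx]
  exact pow_eq_zero_iff two_ne_zero |>.1 (le_antisymm hle (sq_nonneg _))
end
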